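/- Let F be a field and let B_1, B_2 ∈ F^{m×n} be two matrices of the same dimensions. Then the row-space distance satisfies d_S(B_1, B_2) ≤ 2·rank(B_1 − B_2). -/

import Mathlib

/-- The row space of a matrix: the subspace of `F^n` spanned by its rows. -/
def rowSpace {F : Type*} [Field F] {m n : ℕ} (B : Matrix (Fin m) (Fin n) F) :
    Submodule F (Fin n → F) :=
  Submodule.span F (Set.range B)

/-- The row-space distance `d_S(B₁,B₂) = dim(𝓑₁ + 𝓑₂) − dim(𝓑₁ ∩ 𝓑₂)`. -/
noncomputable def rowDist {F : Type*} [Field F] {m₁ m₂ n : ℕ}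
    (B₁ : Matrix (Fin m₁) (Fin n) F) (B₂ : Matrix (Fin m₂) (Fin n) F) : ℕ :=
  Module.finrank F ↥(rowSpace B₁ ⊔ rowSpace B₂) -
    Module.finrank F ↥(rowSpace B₁ ⊓ rowSpace B₂)

/-- For matrices of the same dimensions, `d_S(B₁,B₂) ≤ 2·rank(B₁ − B₂)`. -/
theorem rowDist_le_two_mul_rank_sub {F : Type*} [Field F] {m n : ℕ}
    (B₁ B₂ : Matrix (Fin m) (Fin n) F) :
    rowDist B₁ B₂ ≤ 2 * (B₁ - B₂).rank := by
  have hd : (B₁ - B₂).rank = Module.finrank F ↥(rowSpace (B₁ - B₂)) :=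
    Matrix.rank_eq_finrank_span_row _
  have mem : ∀ (B : Matrix (Fin m) (Fin n) F) (i : Fin m), B i ∈ rowSpace B :=
    fun B i => Submodule.subset_span ⟨i, rfl⟩
  have h1 : rowSpace B₁ ⊔ rowSpace B₂ ≤ rowSpace B₁ ⊔ rowSpace (B₁ - B₂) := by
    refine sup_le le_sup_left (Submodule.span_le.2 ?_)
    rintro _ ⟨i, rfl⟩
    have e : B₂ i = B₁ i - (B₁ - B₂) i := by
      ext j
      simp
    rw [e]
    exact Submodule.sub_mem _ (Submodule.mem_sup_left (mem _ i))
      (Submodule.mem_sup_right (mem _ i))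
  have h2 : rowSpace B₁ ⊔ rowSpace B₂ ≤ rowSpace B₂ ⊔ rowSpace (B₁ - B₂) := by
    refine sup_le (Submodule.span_le.2 ?_) le_sup_left
    rintro _ ⟨i, rfl⟩
    have e : B₁ i = B₂ i + (B₁ - B₂) i := by
      ext j
      simp
    rw [e]
    exact Submodule.add_mem _ (Submodule.mem_sup_left (mem _ i))
      (Submodule.mem_sup_right (mem _ i))
  have f1 := Submodule.finrank_mono h1
  have f2 := Submodule.finrank_mono h2
  have g1 := Submodule.finrank_add_le_finrank_add_finrank (rowSpace B₁) (rowSpace (B₁ - B₂))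
  have g2 := Submodule.finrank_add_le_finrank_add_finrank (rowSpace B₂) (rowSpace (B₁ - B₂))
  have g3 := Submodule.finrank_sup_add_finrank_inf_eq (rowSpace B₁) (rowSpace B₂)
  unfold rowDist
  omega
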